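/- Let F ⊆ G be a field extension and A a finite-dimensional F-algebra. If M and N are finite-dimensional A-modules such that M ⊗_F G ≅ N ⊗_F G as A ⊗_F G-modules, then M ≅ N as A-modules. -/

import Mathlib

set_option synthInstance.maxHeartbeats 1000000
set_option maxHeartbeats 1000000

open scoped TensorProduct

section Precomposition

variable {A X X' X'' : Type*} [Ring A] [AddCommGroup X] [Module A X] [AddCommGroup X']
  [Module A X'] [AddCommGroup X''] [Module A X'']

/-- Precomposition with an `A`-linear map, as an `F`-linear map between spaces of `A`-linear
maps. -/
def precomp (F : Type*) [Field F] (f : X →ₗ[A] X') (Y : Type*) [AddCommGroup Y] [Module A Y]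
    [Module F Y] [SMulCommClass A F Y] : (X' →ₗ[A] Y) →ₗ[F] (X →ₗ[A] Y) where
  toFun g := g ∘ₗ f
  map_add' _ _ := rfl
  map_smul' _ _ := rfl

variable {F Y : Type*} [Field F] [AddCommGroup Y] [Module A Y] [Module F Y] [SMulCommClass A F Y]

@[simp]
theorem precomp_apply (f : X →ₗ[A] X') (g : X' →ₗ[A] Y) : precomp F f Y g = g ∘ₗ f := rfl

theorem precomp_injective {p : X' →ₗ[A] X''} (hp : Function.Surjective p) :
    Function.Injective (precomp F p Y) := fun _ _ h ↦
  (LinearMap.cancel_right hp).mp h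

theorem range_precomp_mkQ (f : X →ₗ[A] X') :
    LinearMap.range (precomp F (LinearMap.range f).mkQ Y) = LinearMap.ker (precomp F f Y) := by
  ext g
  simp only [LinearMap.mem_range, LinearMap.mem_ker, precomp_apply]
  constructor
  · rintro ⟨g, rfl⟩
    rw [LinearMap.comp_assoc, LinearMap.range_mkQ_comp, LinearMap.comp_zero]
  · intro h
    exact ⟨(LinearMap.range f).liftQ g (LinearMap.range_le_ker_iff.mpr h),
      Submodule.liftQ_mkQ _ _ _⟩

end Precomposition

section FiniteDimensional

variable {F A : Type*} [Field F] [Ring A] [Algebra F A]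

theorem finiteDimensional_linearMap (X Y : Type*) [AddCommGroup X] [AddCommGroup Y]
    [Module A X] [Module A Y] [Module F X] [Module F Y] [IsScalarTower F A X]
    [IsScalarTower F A Y] [FiniteDimensional F X] [FiniteDimensional F Y] :
    FiniteDimensional F (X →ₗ[A] Y) :=
  Module.Finite.of_injective (LinearMap.restrictScalarsₗ F A X Y F)
    (LinearMap.restrictScalars_injective F)

theorem finiteDimensional_submodule {X : Type*} [AddCommGroup X] [Module A X] [Module F X]
    [IsScalarTower F A X] [FiniteDimensional F X] (P : Submodule A X) :
    FiniteDimensional F P :=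
  Module.Finite.of_injective (P.subtype.restrictScalars F) P.injective_subtype

theorem finiteDimensional_quotient {X : Type*} [AddCommGroup X] [Module A X] [Module F X]
    [IsScalarTower F A X] [FiniteDimensional F X] (P : Submodule A X) :
    FiniteDimensional F (X ⧸ P) :=
  Module.Finite.of_surjective (P.mkQ.restrictScalars F) P.mkQ_surjective

theorem finrank_range_precomp_add {X X' Y : Type*} [AddCommGroup X] [AddCommGroup X']
    [AddCommGroup Y] [Module A X] [Module A X'] [Module A Y] [Module F X'] [Module F Y]
    [IsScalarTower F A X'] [IsScalarTower F A Y]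
    [FiniteDimensional F X'] [FiniteDimensional F Y] (f : X →ₗ[A] X') :
    Module.finrank F (LinearMap.range (precomp F f Y)) +
      Module.finrank F ((X' ⧸ LinearMap.range f) →ₗ[A] Y) =
        Module.finrank F (X' →ₗ[A] Y) := by
  have := finiteDimensional_linearMap (F := F) (A := A) X' Y
  rw [← LinearMap.finrank_range_add_finrank_ker (precomp F f Y), ← range_precomp_mkQ,
    LinearMap.finrank_range_of_inj (precomp_injective (Submodule.mkQ_surjective _))]

/-- Bongartz: if the dimensions of the spaces of maps into `M` and into `N` agree, then the
identity of `M` factors through a finite power of `N`. -/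
theorem exists_sum_comp_eq_id {M N : Type*} [AddCommGroup M] [AddCommGroup N]
    [Module A M] [Module A N] [Module F M] [Module F N] [IsScalarTower F A M]
    [IsScalarTower F A N] [FiniteDimensional F M] [FiniteDimensional F N]
    (hM : Module.finrank F (M →ₗ[A] M) = Module.finrank F (M →ₗ[A] N))
    (hN : ∀ n : ℕ, ∀ C : Submodule A (Fin n → N),
      Module.finrank F (((Fin n → N) ⧸ C) →ₗ[A] M) =
        Module.finrank F (((Fin n → N) ⧸ C) →ₗ[A] N))
    (hN' : ∀ n : ℕ, Module.finrank F ((Fin n → N) →ₗ[A] M) =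
        Module.finrank F ((Fin n → N) →ₗ[A] N)) :
    ∃ (n : ℕ) (f : Fin n → (M →ₗ[A] N)) (g : Fin n → (N →ₗ[A] M)),
      ∑ i, g i ∘ₗ f i = LinearMap.id := by
  have := finiteDimensional_linearMap (F := F) (A := A) M N
  have := finiteDimensional_linearMap (F := F) (A := A) M M
  let b := Module.finBasis F (M →ₗ[A] N)
  let f : M →ₗ[A] (Fin (Module.finrank F (M →ₗ[A] N)) → N) := LinearMap.pi b
  have hsurj : LinearMap.range (precomp F f N) = ⊤ := by
    rw [eq_top_iff, ← b.span_eq, Submodule.span_le]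
    rintro _ ⟨i, rfl⟩
    exact ⟨LinearMap.proj i, LinearMap.ext fun _ ↦ rfl⟩
  have h₁ := finrank_range_precomp_add (F := F) (Y := M) f
  have h₂ := finrank_range_precomp_add (F := F) (Y := N) f
  rw [hsurj, finrank_top] at h₂
  have hrange : LinearMap.range (precomp F f M) = ⊤ := by
    apply Submodule.eq_top_of_finrank_eq
    have := hN _ (LinearMap.range f)
    have := hN' (Module.finrank F (M →ₗ[A] N))
    omega
  obtain ⟨g, hg⟩ := LinearMap.range_eq_top.mp hrange LinearMap.id
  refine ⟨_, b, fun i ↦ g ∘ₗ LinearMap.single A (fun _ ↦ N) i, ?_⟩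
  rw [← hg]
  ext x
  simp only [LinearMap.sum_apply, LinearMap.comp_apply, precomp_apply]
  rw [← map_sum]
  congr 1
  exact LinearMap.sum_single_apply (fun _ ↦ N) (f x)

end FiniteDimensional

section Indecomposable

variable {A M : Type*} [Ring A] [AddCommGroup M] [Module A M]

theorem exists_isCompl_indecomposable [IsArtinian A M] [Nontrivial M] :
    ∃ P Q : Submodule A M, IsCompl P Q ∧ P ≠ ⊥ ∧
      ∀ K R : Submodule A P, IsCompl K R → K = ⊥ ∨ K = ⊤ := by
  let S : Set (Submodule A M) := {P | P ≠ ⊥ ∧ ∃ Q, IsCompl P Q}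
  obtain ⟨P, ⟨hP, Q, hPQ⟩, hmin⟩ :=
    wellFounded_lt.has_min S ⟨⊤, top_ne_bot, ⊥, isCompl_top_bot⟩
  refine ⟨P, Q, hPQ, hP, fun K R hKR ↦ or_iff_not_imp_left.mpr fun hK ↦ ?_⟩
  have hsup : K.map P.subtype ⊔ R.map P.subtype = P := by
    rw [← Submodule.map_sup, hKR.sup_eq_top, Submodule.map_subtype_top]
  have hdisj : Disjoint (K.map P.subtype) (R.map P.subtype) :=
    (Submodule.disjoint_map P.injective_subtype hKR.disjoint)
  have hmem : K.map P.subtype ∈ S := by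
    refine ⟨fun h ↦ hK (Submodule.map_injective_of_injective P.injective_subtype
      (h.trans (Submodule.map_bot _).symm)),
      R.map P.subtype ⊔ Q, ?_, ?_⟩
    · exact hdisj.disjoint_sup_right_of_disjoint_sup_left (hsup.symm ▸ hPQ.disjoint)
    · rw [codisjoint_iff, ← sup_assoc, hsup, hPQ.sup_eq_top]
  have heq : K.map P.subtype = P :=
    (Submodule.map_subtype_le P K).eq_of_not_lt (hmin _ hmem)
  apply Submodule.map_injective_of_injective P.injective_subtype
  rw [heq, Submodule.map_subtype_top]

variable [IsArtinian A M] [IsNoetherian A M]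

theorem isNilpotent_or_isUnit_of_indecomposable
    (h : ∀ K R : Submodule A M, IsCompl K R → K = ⊥ ∨ K = ⊤) (f : Module.End A M) :
    IsNilpotent f ∨ IsUnit f := by
  obtain ⟨n, hn, hn'⟩ :=
    (f.eventually_isCompl_ker_pow_range_pow.and (Filter.eventually_ge_atTop 1)).exists
  rcases h _ _ hn with hker | hker
  · right
    have hrange := hn.sup_eq_top
    rw [hker, bot_sup_eq] at hrange
    have hunit : IsUnit (f ^ n) := (Module.End.isUnit_iff _).mpr
      ⟨LinearMap.ker_eq_bot.mp hker, LinearMap.range_eq_top.mp hrange⟩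
    exact (isUnit_pow_iff (by omega)).mp hunit
  · exact .inl ⟨n, LinearMap.ker_eq_top.mp hker⟩

theorem isUnit_or_isUnit_of_isUnit_add_of_indecomposable
    (h : ∀ K R : Submodule A M, IsCompl K R → K = ⊥ ∨ K = ⊤) {f g : Module.End A M}
    (hfg : IsUnit (f + g)) : IsUnit f ∨ IsUnit g := by
  obtain ⟨u, hu⟩ := hfg
  have hsum : ↑u⁻¹ * f + ↑u⁻¹ * g = 1 := by rw [← mul_add, ← hu, Units.inv_mul]
  rcases isNilpotent_or_isUnit_of_indecomposable h (↑u⁻¹ * f) with hf | hf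
  · right
    rw [← Units.isUnit_units_mul u⁻¹, ← sub_eq_of_eq_add' hsum.symm]
    exact hf.isUnit_one_sub
  · exact .inl ((Units.isUnit_units_mul u⁻¹ f).mp hf)

theorem exists_isUnit_of_isUnit_sum_of_indecomposable [Nontrivial M]
    (h : ∀ K R : Submodule A M, IsCompl K R → K = ⊥ ∨ K = ⊤) {ι : Type*} (s : Finset ι)
    (f : ι → Module.End A M) (hf : IsUnit (∑ i ∈ s, f i)) : ∃ i ∈ s, IsUnit (f i) := by
  classical
  induction s using Finset.induction_on with
  | empty => simp at hf
  | insert i s hi ih =>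
    rw [Finset.sum_insert hi] at hf
    rcases isUnit_or_isUnit_of_isUnit_add_of_indecomposable h hf with hf | hf
    · exact ⟨i, Finset.mem_insert_self _ _, hf⟩
    · obtain ⟨j, hj, hfj⟩ := ih hf
      exact ⟨j, Finset.mem_insert_of_mem hj, hfj⟩

end Indecomposable

/-- A linear map with a left inverse splits off its domain as a direct summand. -/
noncomputable def prodKerEquivOfCompEqId {A P N : Type*} [Ring A] [AddCommGroup P]
    [AddCommGroup N] [Module A P] [Module A N] (f : P →ₗ[A] N) (g : N →ₗ[A] P)
    (h : g ∘ₗ f = LinearMap.id) : (P × LinearMap.ker g) ≃ₗ[A] N :=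
  have hgf (x : P) : g (f x) = x := LinearMap.congr_fun h x
  LinearEquiv.ofBijective (f.coprod (LinearMap.ker g).subtype) <| by
    constructor
    · rw [injective_iff_map_eq_zero]
      rintro ⟨x, y, hy⟩ hxy
      rw [LinearMap.mem_ker] at hy
      simp only [LinearMap.coprod_apply, Submodule.subtype_apply] at hxy
      have hx : x = 0 := by simpa [hgf, hy] using congrArg g hxy
      subst hx
      simpa using hxy
    · intro y
      exact ⟨(g y, ⟨y - f (g y), by simp [hgf]⟩), by simp⟩

section Auslander

universe u

variable {F : Type*} {A : Type*} [Field F] [Ring A] [Algebra F A]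

theorem finrank_linearMap_congr {X M N : Type*} [AddCommGroup X] [AddCommGroup M]
    [AddCommGroup N] [Module A X] [Module A M] [Module A N] [Module F M] [Module F N]
    [IsScalarTower F A M] [IsScalarTower F A N] (e : M ≃ₗ[A] N) :
    Module.finrank F (X →ₗ[A] M) = Module.finrank F (X →ₗ[A] N) :=
  LinearEquiv.finrank_eq
    { toFun f := e.toLinearMap ∘ₗ f
      invFun f := e.symm.toLinearMap ∘ₗ f
      left_inv f := by ext; simp
      right_inv f := by ext; simp
      map_add' f g := by ext; simp
      map_smul' c f := by
        ext x
        exact (e.restrictScalars F).map_smul c (f x) }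

theorem finrank_linearMap_prod {X M N : Type*} [AddCommGroup X] [AddCommGroup M]
    [AddCommGroup N] [Module A X] [Module A M] [Module A N] [Module F X] [Module F M] [Module F N]
    [IsScalarTower F A X] [IsScalarTower F A M] [IsScalarTower F A N]
    [FiniteDimensional F X] [FiniteDimensional F M] [FiniteDimensional F N] :
    Module.finrank F (X →ₗ[A] M × N) =
      Module.finrank F (X →ₗ[A] M) + Module.finrank F (X →ₗ[A] N) := by
  have := finiteDimensional_linearMap (F := F) (A := A) X M
  have := finiteDimensional_linearMap (F := F) (A := A) X N
  rw [← Module.finrank_prod]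
  exact (LinearMap.prodEquiv F).finrank_eq.symm

theorem subsingleton_of_finrank_end_eq_zero {M : Type*} [AddCommGroup M] [Module A M]
    [Module F M] [IsScalarTower F A M] [FiniteDimensional F M]
    (h : Module.finrank F (M →ₗ[A] M) = 0) : Subsingleton M := by
  have := finiteDimensional_linearMap (F := F) (A := A) M M
  have := Module.finrank_zero_iff.mp h
  refine subsingleton_of_forall_eq 0 fun x ↦ ?_
  exact LinearMap.congr_fun (Subsingleton.elim (LinearMap.id : M →ₗ[A] M) 0) x

/-- **Auslander's theorem**: a finite-dimensional module `M` is determined up to isomorphism by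
the dimensions of the spaces of maps from finite-dimensional modules into `M`. -/
theorem nonempty_linearEquiv_of_finrank_linearMap_eq (M N : Type u) [AddCommGroup M]
    [AddCommGroup N] [Module A M] [Module A N] [Module F M] [Module F N]
    [IsScalarTower F A M] [IsScalarTower F A N] [FiniteDimensional F M] [FiniteDimensional F N]
    (h : ∀ (X : Type u) [AddCommGroup X] [Module A X] [Module F X] [IsScalarTower F A X]
      [FiniteDimensional F X],
      Module.finrank F (X →ₗ[A] M) = Module.finrank F (X →ₗ[A] N)) :
    Nonempty (M ≃ₗ[A] N) := by
  induction hd : Module.finrank F M using Nat.strong_induction_on generalizing M N with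
  | _ d ih =>
  rcases subsingleton_or_nontrivial M with hM | hM
  · have : Subsingleton N := by
      apply subsingleton_of_finrank_end_eq_zero (F := F) (A := A)
      rw [← h N]
      exact Module.finrank_zero_of_subsingleton
    exact ⟨0, 0, fun _ ↦ Subsingleton.elim _ _, fun _ ↦ Subsingleton.elim _ _⟩
  have : IsArtinian A M := isArtinian_of_tower F inferInstance
  have : IsNoetherian A M := isNoetherian_of_tower F inferInstance
  obtain ⟨P, Q, hPQ, hP, hind⟩ := exists_isCompl_indecomposable (A := A) (M := M)
  have : Nontrivial P := Submodule.nontrivial_iff_ne_bot.mpr hP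
  obtain ⟨n, f, g, hfg⟩ := exists_sum_comp_eq_id (F := F) (h M)
    (fun n C ↦ have := finiteDimensional_quotient (F := F) C; h _) (fun n ↦ h _)
  have hsum : ∑ i, (P.projectionOnto Q hPQ ∘ₗ g i) ∘ₗ (f i ∘ₗ P.subtype) =
      (1 : Module.End A P) := by
    ext x
    have := LinearMap.congr_fun hfg x
    simp only [LinearMap.sum_apply, LinearMap.comp_apply, LinearMap.id_apply] at this
    simp [← map_sum, this]
  obtain ⟨i, -, u, hu⟩ := exists_isUnit_of_isUnit_sum_of_indecomposable hind Finset.univ _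
    (hsum ▸ isUnit_one)
  let r : N →ₗ[A] P := (↑u⁻¹ : Module.End A P) ∘ₗ P.projectionOnto Q hPQ ∘ₗ g i
  have hr : r ∘ₗ (f i ∘ₗ P.subtype) = LinearMap.id := by
    have := u.inv_mul
    rwa [hu] at this
  let eM := P.prodEquivOfIsCompl Q hPQ
  let eN := prodKerEquivOfCompEqId _ r hr
  have := finiteDimensional_submodule (F := F) P
  have := finiteDimensional_submodule (F := F) Q
  have := finiteDimensional_submodule (F := F) (LinearMap.ker r)
  have hlt : Module.finrank F Q < d := by
    have h₁ := (eM.restrictScalars F).finrank_eq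
    have h₂ : 0 < Module.finrank F P := Module.finrank_pos
    rw [Module.finrank_prod] at h₁
    omega
  obtain ⟨e⟩ := ih _ hlt Q (LinearMap.ker r) (fun X _ _ _ _ _ ↦ by
    have hX := h X
    rw [← finrank_linearMap_congr eM, ← finrank_linearMap_congr eN, finrank_linearMap_prod,
      finrank_linearMap_prod] at hX
    omega) rfl
  exact ⟨eM.symm ≪≫ₗ (LinearEquiv.refl A P).prodCongr e ≪≫ₗ eN⟩

end Auslander

section ExtensionOfScalars

variable (F G A : Type*) [Field F] [Field G] [Algebra F G] [Ring A] [Algebra F A]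

/-- Extending scalars of the target commutes with forming spaces of `A`-linear maps. -/
noncomputable def homTensorMap (X M : Type*) [AddCommGroup X] [AddCommGroup M] [Module A X]
    [Module A M] [Module F M] [IsScalarTower F A M] :
    (X →ₗ[A] M) ⊗[F] G →ₗ[F] (X →ₗ[A] M ⊗[F] G) :=
  TensorProduct.lift <| LinearMap.mk₂ F
    (fun f g ↦ (TensorProduct.AlgebraTensorModule.mk F A M G).flip g ∘ₗ f)
    (fun f f' g ↦ by ext; simp [TensorProduct.add_tmul])
    (fun c f g ↦ by ext; simp [TensorProduct.smul_tmul'])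
    (fun f g g' ↦ by ext; simp)
    (fun c f g ↦ by ext; simp)

variable {F G A} {X M N : Type*} [AddCommGroup X] [AddCommGroup M] [AddCommGroup N]
  [Module A X] [Module A M] [Module F M] [IsScalarTower F A M]
  [Module A N] [Module F N] [IsScalarTower F A N]

@[simp]
theorem homTensorMap_tmul_apply (f : X →ₗ[A] M) (g : G) (x : X) :
    homTensorMap F G A X M (f ⊗ₜ g) x = f x ⊗ₜ g := rfl

theorem homTensorMap_lTensor_mulLeft (g : G) (t : (X →ₗ[A] M) ⊗[F] G) (x : X) :
    homTensorMap F G A X M (LinearMap.lTensor _ (LinearMap.mulLeft F g) t) x =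
      LinearMap.lTensor M (LinearMap.mulLeft F g) (homTensorMap F G A X M t x) := by
  induction t with
  | zero => simp
  | add s t hs ht => simp [hs, ht]
  | tmul f g' => simp

/-- The coordinates of an element of `M ⊗ G` along a basis of `G`, as `A`-linear maps. -/
noncomputable def tensorCoord {ι : Type*} (b : Module.Basis ι F G) (i : ι) :
    M ⊗[F] G →ₗ[A] M :=
  (TensorProduct.AlgebraTensorModule.rid F A M).toLinearMap ∘ₗ
    TensorProduct.AlgebraTensorModule.lTensor A M (b.coord i)

theorem tensorCoord_tmul {ι : Type*} (b : Module.Basis ι F G) (i : ι) (m : M) (g : G) :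
    tensorCoord (A := A) b i (m ⊗ₜ g) = b.repr g i • m := by
  simp [tensorCoord]

theorem equivFinsuppOfBasisRight_eq_tensorCoord {ι : Type*} [DecidableEq ι]
    (b : Module.Basis ι F G) (i : ι) (t : M ⊗[F] G) :
    TensorProduct.equivFinsuppOfBasisRight b t i = tensorCoord (A := A) b i t := by
  induction t with
  | zero => simp
  | add s t hs ht => simp [hs, ht]
  | tmul m g => rw [TensorProduct.equivFinsuppOfBasisRight_apply_tmul_apply, tensorCoord_tmul]

theorem tensorCoord_homTensorMap {ι : Type*} [DecidableEq ι] (b : Module.Basis ι F G) (i : ι)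
    (t : (X →ₗ[A] M) ⊗[F] G) (x : X) :
    tensorCoord (A := A) b i (homTensorMap F G A X M t x) =
      TensorProduct.equivFinsuppOfBasisRight b t i x := by
  induction t with
  | zero => simp
  | add s t hs ht => simp only [map_add, LinearMap.add_apply, Finsupp.add_apply, hs, ht]
  | tmul f g =>
    rw [homTensorMap_tmul_apply, tensorCoord_tmul,
      TensorProduct.equivFinsuppOfBasisRight_apply_tmul_apply, LinearMap.smul_apply]

theorem homTensorMap_injective : Function.Injective (homTensorMap F G A X M) := by
  classical
  let b := Module.Basis.ofVectorSpace F G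
  rw [injective_iff_map_eq_zero]
  intro t ht
  apply (TensorProduct.equivFinsuppOfBasisRight b).injective
  ext i x
  rw [← tensorCoord_homTensorMap, ht]
  simp

variable [Module F X] [IsScalarTower F A X] [FiniteDimensional F X]

theorem homTensorMap_surjective : Function.Surjective (homTensorMap F G A X M) := by
  classical
  intro φ
  let b := Module.Basis.ofVectorSpace F G
  let c := Module.finBasis F X
  let S := Finset.univ.biUnion fun k ↦
    (TensorProduct.equivFinsuppOfBasisRight b (φ (c k))).support
  have hS : ∀ i, tensorCoord (A := A) b i ∘ₗ φ ≠ 0 → i ∈ S := by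
    intro i
    contrapose!
    intro hi
    apply LinearMap.restrictScalars_injective F
    refine c.ext fun k ↦ ?_
    by_contra hk
    refine hi (Finset.mem_biUnion.mpr ⟨k, Finset.mem_univ _, ?_⟩)
    rw [Finsupp.mem_support_iff, equivFinsuppOfBasisRight_eq_tensorCoord (A := A)]
    exact hk
  refine ⟨(TensorProduct.equivFinsuppOfBasisRight b).symm (Finsupp.onFinset S _ hS), ?_⟩
  ext x
  apply (TensorProduct.equivFinsuppOfBasisRight b).injective
  ext i
  rw [equivFinsuppOfBasisRight_eq_tensorCoord (A := A),
    equivFinsuppOfBasisRight_eq_tensorCoord (A := A), tensorCoord_homTensorMap,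
    LinearEquiv.apply_symm_apply, Finsupp.onFinset_apply, LinearMap.comp_apply]

theorem comm_smul {U : Type*} [AddCommGroup U] [Module F U] (g : G) (t : G ⊗[F] U) :
    TensorProduct.comm F G U (g • t) =
      LinearMap.lTensor U (LinearMap.mulLeft F g) (TensorProduct.comm F G U t) := by
  induction t with
  | zero => simp
  | add s t hs ht => simp only [smul_add, map_add, hs, ht]
  | tmul g' u => simp [TensorProduct.smul_tmul']

theorem finrank_eq_of_tensorProduct_equiv {V W : Type*} [AddCommGroup V] [AddCommGroup W]
    [Module F V] [Module F W] (e : V ⊗[F] G ≃+ W ⊗[F] G)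
    (he : ∀ (g : G) (t : V ⊗[F] G), e (LinearMap.lTensor V (LinearMap.mulLeft F g) t) =
      LinearMap.lTensor W (LinearMap.mulLeft F g) (e t)) :
    Module.finrank F V = Module.finrank F W := by
  let ψ : G ⊗[F] V ≃+ G ⊗[F] W := (TensorProduct.comm F G V).toAddEquiv.trans
    (e.trans (TensorProduct.comm F G W).symm.toAddEquiv)
  have hψ (g : G) (t : G ⊗[F] V) : ψ (g • t) = g • ψ t := by
    apply (TensorProduct.comm F G W).injective
    rw [comm_smul]
    suffices e (TensorProduct.comm F G V (g • t)) =
        LinearMap.lTensor W (LinearMap.mulLeft F g) (e (TensorProduct.comm F G V t)) by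
      simpa [ψ] using this
    rw [comm_smul, he]
  have := (ψ.toLinearEquiv hψ).finrank_eq
  rwa [Module.finrank_baseChange, Module.finrank_baseChange] at this

theorem finrank_linearMap_eq_of_tensorProduct_equiv (e : (M ⊗[F] G) ≃ₗ[A] (N ⊗[F] G))
    (he : ∀ (g : G) (x : M ⊗[F] G),
      e (LinearMap.lTensor M (LinearMap.mulLeft F g) x) =
        LinearMap.lTensor N (LinearMap.mulLeft F g) (e x)) :
    Module.finrank F (X →ₗ[A] M) = Module.finrank F (X →ₗ[A] N) := by
  let eM := LinearEquiv.ofBijective (homTensorMap F G A X M)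
    ⟨homTensorMap_injective, homTensorMap_surjective⟩
  let eN := LinearEquiv.ofBijective (homTensorMap F G A X N)
    ⟨homTensorMap_injective, homTensorMap_surjective⟩
  let ε : (X →ₗ[A] M ⊗[F] G) ≃+ (X →ₗ[A] N ⊗[F] G) :=
    { toFun f := e.toLinearMap ∘ₗ f
      invFun f := e.symm.toLinearMap ∘ₗ f
      left_inv f := by ext; simp
      right_inv f := by ext; simp
      map_add' f g := by ext; simp }
  refine finrank_eq_of_tensorProduct_equiv
    (eM.toAddEquiv.trans (ε.trans eN.symm.toAddEquiv)) fun g t ↦ ?_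
  apply eN.injective
  ext x
  have hN (s : (X →ₗ[A] N) ⊗[F] G) :
      eN (LinearMap.lTensor _ (LinearMap.mulLeft F g) s) x =
        LinearMap.lTensor N (LinearMap.mulLeft F g) (eN s x) :=
    homTensorMap_lTensor_mulLeft g s x
  have hM : eM (LinearMap.lTensor _ (LinearMap.mulLeft F g) t) x =
        LinearMap.lTensor M (LinearMap.mulLeft F g) (eM t x) :=
    homTensorMap_lTensor_mulLeft g t x
  rw [hN]
  simp [ε, hM, he]

end ExtensionOfScalars

/-- The Noether–Deuring theorem.  Let `F ⊆ G` be a field extension and `A` a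
finite-dimensional `F`-algebra.  If `M` and `N` are finite-dimensional `A`-modules such
that `M ⊗_F G ≅ N ⊗_F G` as `A ⊗_F G`-modules — i.e. via an `A`-linear isomorphism which
also commutes with the action of `G` on the right tensor factor — then `M ≅ N` as
`A`-modules. -/
theorem noether_deuring (F G A : Type) [Field F] [Field G] [Algebra F G]
    [Ring A] [Algebra F A] [FiniteDimensional F A]
    (M N : Type) [AddCommGroup M] [AddCommGroup N]
    [Module A M] [Module A N] [Module F M] [Module F N]
    [IsScalarTower F A M] [IsScalarTower F A N]
    [FiniteDimensional F M] [FiniteDimensional F N]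
    (h : ∃ e : (M ⊗[F] G) ≃ₗ[A] (N ⊗[F] G),
      ∀ (g : G) (x : M ⊗[F] G),
        e (LinearMap.lTensor M (LinearMap.mulLeft F g) x) =
          LinearMap.lTensor N (LinearMap.mulLeft F g) (e x)) :
    Nonempty (M ≃ₗ[A] N) := by
  obtain ⟨e, he⟩ := h
  exact nonempty_linearEquiv_of_finrank_linearMap_eq (F := F) M N fun X _ _ _ _ _ ↦
    finrank_linearMap_eq_of_tensorProduct_equiv e he
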